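/- arXiv:1312.1497 — 4 statements merged into one kernel-verified Lean document; each statement's English description precedes it below -/
import Mathlib

section
/- Let C be a category of partitions. For l ≥ 1 let k_l ∈ P(l+2, l+2) be the partition consisting of the four-block {1, 1', l+2, (l+2)'} together with the pair blocks {j, j'} for 2 ≤ j ≤ l+1 (upper points 1,…,l+2, lower points 1',…,(l+2)'). Then the pair positioner partition ▷ belongs to C if and only if k_l belongs to C for every l ≥ 1. -/
open Classical

/-- A partition diagram with `upper` upper points and `lower` lower points; the blocks are
encoded by the equivalence relation (setoid) on the disjoint union of the points. -/
structure PartitionDiagram where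
  upper : ℕ
  lower : ℕ
  rel : Setoid (Fin upper ⊕ Fin lower)

namespace PartitionDiagram

/-- The partition determined by a labelling of the points: two points lie in the same block
iff they receive the same label. -/
def ofLabels {u l : ℕ} (f : Fin u ⊕ Fin l → ℕ) : PartitionDiagram :=
  ⟨u, l, Setoid.ker f⟩

/-- The identity partition `| ∈ P(1,1)`. -/
def idPartition : PartitionDiagram := ofLabels (u := 1) (l := 1) fun _ => 0

/-- The pair partition `⊓ ∈ P(0,2)`. -/
def pairPartition : PartitionDiagram := ofLabels (u := 0) (l := 2) fun _ => 0

/-- The four block partition `⊓⊓ ∈ P(0,4)`. -/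
def fourBlock : PartitionDiagram := ofLabels (u := 0) (l := 4) fun _ => 0

/-- The singleton partition `↑ ∈ P(0,1)`. -/
def singletonPartition : PartitionDiagram := ofLabels (u := 0) (l := 1) fun _ => 0

/-- The double singleton partition `↑⊗↑ ∈ P(0,2)`. -/
def doubleSingleton : PartitionDiagram :=
  ofLabels (u := 0) (l := 2) (Sum.elim (fun i => (i : ℕ)) fun j => (j : ℕ))

/-- The crossing partition `⨯ ∈ P(2,2)`, with blocks `{1,2'}` and `{2,1'}`. -/
def crossing : PartitionDiagram :=
  ofLabels (u := 2) (l := 2) (Sum.elim (fun i => (i : ℕ)) fun j => 1 - (j : ℕ))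

/-- The pair positioner partition `▷ ∈ P(3,3)`, with blocks `{1,2,2',3'}` and `{3,1'}`. -/
def pairPositioner : PartitionDiagram :=
  ofLabels (u := 3) (l := 3)
    (Sum.elim (fun i => if (i : ℕ) = 2 then 1 else 0) fun j => if (j : ℕ) = 0 then 1 else 0)

/-- The partition `k_l ∈ P(l+2, l+2)` consisting of the four block `{1, 1', l+2, (l+2)'}`
together with the pairs `{j, j'}` for `2 ≤ j ≤ l+1`. -/
def kPart (n : ℕ) : PartitionDiagram :=
  ofLabels (u := n + 2) (l := n + 2)
    (fun x => if (Sum.elim Fin.val Fin.val x) = 0 ∨ (Sum.elim Fin.val Fin.val x) = n + 1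
      then 0 else Sum.elim Fin.val Fin.val x)

/-- The involution `p* ∈ P(l,k)` of `p ∈ P(k,l)`: turn the partition upside down. -/
def invol (p : PartitionDiagram) : PartitionDiagram :=
  ⟨p.lower, p.upper, Setoid.comap Sum.swap p.rel⟩

/-- Auxiliary map splitting the points of a tensor product into the points of the two factors. -/
def splitPoint {a b c d : ℕ} (x : Fin (a + b) ⊕ Fin (c + d)) :
    (Fin a ⊕ Fin c) ⊕ (Fin b ⊕ Fin d) :=
  match x with
  | Sum.inl u =>
    match finSumFinEquiv.symm u with
    | Sum.inl i => Sum.inl (Sum.inl i)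
    | Sum.inr i => Sum.inr (Sum.inl i)
  | Sum.inr v =>
    match finSumFinEquiv.symm v with
    | Sum.inl j => Sum.inl (Sum.inr j)
    | Sum.inr j => Sum.inr (Sum.inr j)

/-- The tensor product (horizontal concatenation) `p ⊗ q` of two partitions. -/
def tensor (p q : PartitionDiagram) : PartitionDiagram :=
  ⟨p.upper + q.upper, p.lower + q.lower,
    Setoid.ker fun x =>
      Sum.map (Quotient.mk p.rel) (Quotient.mk q.rel) (splitPoint x)⟩

section Composition

variable (p q : PartitionDiagram) (h : p.lower = q.upper)

/-- Inclusion of the points of `p` into the three-row diagram used for composition. -/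
def iotaP : Fin p.upper ⊕ Fin p.lower → Fin p.upper ⊕ (Fin p.lower ⊕ Fin q.lower) :=
  Sum.map id Sum.inl

/-- Inclusion of the points of `q` into the three-row diagram used for composition,
identifying the upper points of `q` with the lower points of `p`. -/
def iotaQ : Fin q.upper ⊕ Fin q.lower → Fin p.upper ⊕ (Fin p.lower ⊕ Fin q.lower) :=
  fun x => Sum.inr (Sum.map (Fin.cast h.symm) id x)

/-- The generating relation on the three-row diagram used for composition. -/
def compRel : Fin p.upper ⊕ (Fin p.lower ⊕ Fin q.lower) →
    Fin p.upper ⊕ (Fin p.lower ⊕ Fin q.lower) → Prop :=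
  fun x y =>
    (∃ a b, p.rel.r a b ∧ x = iotaP p q a ∧ y = iotaP p q b) ∨
    (∃ a b, q.rel.r a b ∧ x = iotaQ p q h a ∧ y = iotaQ p q h b)

/-- The composition (vertical concatenation) `qp ∈ P(k,m)` of `p ∈ P(k,l)` and `q ∈ P(l,m)`:
identify the lower points of `p` with the upper points of `q`, take the join of the block
structures and restrict to the upper points of `p` and the lower points of `q`. -/
def comp : PartitionDiagram :=
  ⟨p.upper, q.lower,
    Setoid.comap (Sum.map id Sum.inr) (Relation.EqvGen.setoid (compRel p q h))⟩

end Composition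

/-- Rotation of the leftmost upper point to the leftmost lower position. -/
def rotLU (p : PartitionDiagram) (h : 0 < p.upper) : PartitionDiagram :=
  ⟨p.upper - 1, p.lower + 1,
    Setoid.comap (fun x => match x with
      | Sum.inl j => Sum.inl (⟨(j : ℕ) + 1, by have := j.isLt; omega⟩ : Fin p.upper)
      | Sum.inr j => if hj : (j : ℕ) = 0 then Sum.inl (⟨0, h⟩ : Fin p.upper)
          else Sum.inr (⟨(j : ℕ) - 1, by have := j.isLt; omega⟩ : Fin p.lower)) p.rel⟩

/-- Rotation of the leftmost lower point to the leftmost upper position. -/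
def rotLD (p : PartitionDiagram) (h : 0 < p.lower) : PartitionDiagram :=
  ⟨p.upper + 1, p.lower - 1,
    Setoid.comap (fun x => match x with
      | Sum.inl j => if hj : (j : ℕ) = 0 then Sum.inr (⟨0, h⟩ : Fin p.lower)
          else Sum.inl (⟨(j : ℕ) - 1, by have := j.isLt; omega⟩ : Fin p.upper)
      | Sum.inr j => Sum.inr (⟨(j : ℕ) + 1, by have := j.isLt; omega⟩ : Fin p.lower)) p.rel⟩

/-- Rotation of the rightmost upper point to the rightmost lower position. -/
def rotRU (p : PartitionDiagram) (h : 0 < p.upper) : PartitionDiagram :=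
  ⟨p.upper - 1, p.lower + 1,
    Setoid.comap (fun x => match x with
      | Sum.inl j => Sum.inl (⟨(j : ℕ), by have := j.isLt; omega⟩ : Fin p.upper)
      | Sum.inr j => if hj : (j : ℕ) < p.lower then Sum.inr (⟨(j : ℕ), hj⟩ : Fin p.lower)
          else Sum.inl (⟨p.upper - 1, by omega⟩ : Fin p.upper)) p.rel⟩

/-- Rotation of the rightmost lower point to the rightmost upper position. -/
def rotRD (p : PartitionDiagram) (h : 0 < p.lower) : PartitionDiagram :=
  ⟨p.upper + 1, p.lower - 1,
    Setoid.comap (fun x => match x with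
      | Sum.inl j => if hj : (j : ℕ) < p.upper then Sum.inl (⟨(j : ℕ), hj⟩ : Fin p.upper)
          else Sum.inr (⟨p.lower - 1, by omega⟩ : Fin p.lower)
      | Sum.inr j => Sum.inr (⟨(j : ℕ), by have := j.isLt; omega⟩ : Fin p.lower)) p.rel⟩

/-- The partition obtained from `p` by merging the block of the point `a` and the block of
the point `b` into a single block, leaving all other blocks unchanged. -/
noncomputable def mergeBlocks (p : PartitionDiagram)
    (a b : Fin p.upper ⊕ Fin p.lower) : PartitionDiagram :=
  ⟨p.upper, p.lower,
    Setoid.ker fun x =>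
      if p.rel.r x a ∨ p.rel.r x b then (none : Option (Quotient p.rel))
      else some (Quotient.mk p.rel x)⟩

end PartitionDiagram

open PartitionDiagram

/-- A set of partitions is a category of partitions if it contains the identity partition and
the pair partition and is closed under tensor products, composition, involution and the four
rotation operations. -/
structure IsPartitionCategory (M : Set PartitionDiagram) : Prop where
  id_mem : idPartition ∈ M
  pair_mem : pairPartition ∈ M
  tensor_mem : ∀ p ∈ M, ∀ q ∈ M, tensor p q ∈ M
  comp_mem : ∀ p ∈ M, ∀ q ∈ M, ∀ h : p.lower = q.upper, comp p q h ∈ M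
  invol_mem : ∀ p ∈ M, invol p ∈ M
  rotLU_mem : ∀ p ∈ M, ∀ h : 0 < p.upper, rotLU p h ∈ M
  rotLD_mem : ∀ p ∈ M, ∀ h : 0 < p.lower, rotLD p h ∈ M
  rotRU_mem : ∀ p ∈ M, ∀ h : 0 < p.upper, rotRU p h ∈ M
  rotRD_mem : ∀ p ∈ M, ∀ h : 0 < p.lower, rotRD p h ∈ M

/-- A category of partitions is group-theoretical if it contains the pair positioner
partition `▷`. -/
def IsGroupTheoreticalCategory (M : Set PartitionDiagram) : Prop :=
  IsPartitionCategory M ∧ pairPositioner ∈ M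

/-- The smallest category of partitions containing a given set of partitions. -/
def generatedCategory (S : Set PartitionDiagram) : Set PartitionDiagram :=
  ⋂₀ { M | IsPartitionCategory M ∧ S ⊆ M }

/-- The group `Z_2^{*∞}`: the free product of countably many copies of the cyclic group of
order two. -/
abbrev FreeZ2 := Monoid.CoprodI (fun _ : ℕ => Multiplicative (ZMod 2))

/-- The free generators `a_1, a_2, …` of `Z_2^{*∞}`, each of order two. -/
def gen (n : ℕ) : FreeZ2 :=
  Monoid.CoprodI.of (i := n) (Multiplicative.ofAdd (1 : ZMod 2))

/-- A labelling of a partition assigns (indices of) pairwise distinct generators of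
`Z_2^{*∞}` to the blocks: two points receive the same label iff they lie in the same block. -/
def IsLabelling (p : PartitionDiagram) (lab : Fin p.upper ⊕ Fin p.lower → ℕ) : Prop :=
  ∀ x y, lab x = lab y ↔ p.rel.r x y

/-- The word `w(p,l) ∈ Z_2^{*∞}` of a labelled partition: after rotating all upper points to
the right-hand end of the lower row, read off the generators assigned to the points from left
to right, i.e. read the lower points from left to right and then the upper points from right
to left. -/
def wordOf (p : PartitionDiagram) (lab : Fin p.upper ⊕ Fin p.lower → ℕ) : FreeZ2 :=
  ((List.ofFn fun j : Fin p.lower => gen (lab (Sum.inr j))) ++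
    (List.ofFn fun i : Fin p.upper => gen (lab (Sum.inl i))).reverse).prod

/-- `F(C) ⊆ Z_2^{*∞}` is the set of all `w(p,l)` where `p ∈ C` and `l` is a labelling. -/
def Fmap (M : Set PartitionDiagram) : Set FreeZ2 :=
  { g | ∃ p ∈ M, ∃ lab, IsLabelling p lab ∧ wordOf p lab = g }

/-- The set of partitions admitting a labelling whose word lies in `H`. -/
def catOf (H : Set FreeZ2) : Set PartitionDiagram :=
  { p | ∃ lab, IsLabelling p lab ∧ wordOf p lab ∈ H }

/-- The endomorphism of `Z_2^{*∞}` identifying letters according to `f`, i.e. sending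
`a_k` to `a_{f k}` for every `k`. -/
def identifyLetters (f : ℕ → ℕ) : Monoid.End FreeZ2 :=
  Monoid.CoprodI.lift fun i =>
    (Monoid.CoprodI.of (M := fun _ : ℕ => Multiplicative (ZMod 2)) (i := f i))

/-- The strong symmetric semigroup `sS_∞`: the subsemigroup of `End(Z_2^{*∞})` generated by
the finite identifications of letters. -/
def strongSymmetricSemigroup : Subsemigroup (Monoid.End FreeZ2) :=
  Subsemigroup.closure
    { φ | ∃ f : ℕ → ℕ, (∃ n : ℕ, ∀ k, n ≤ k → f k = k) ∧ φ = identifyLetters f }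

/-- A subset of `Z_2^{*∞}` is `sS_∞`-invariant if it is preserved by every element of the
strong symmetric semigroup. -/
def IsSSInvariant (H : Set FreeZ2) : Prop :=
  ∀ φ ∈ strongSymmetricSemigroup, ∀ g ∈ H, φ g ∈ H

/-- A partition is in single leg form if it has no upper points and no two consecutive
points belong to the same block. -/
def IsSingleLeg (p : PartitionDiagram) : Prop :=
  p.upper = 0 ∧
    ∀ i j : Fin p.lower, (j : ℕ) = (i : ℕ) + 1 → ¬ p.rel.r (Sum.inr i) (Sum.inr j)

/-- `C_sl`: the set of all partitions in `C` with no upper points in single leg form. -/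
def slSet (M : Set PartitionDiagram) : Set PartitionDiagram :=
  { p ∈ M | IsSingleLeg p }

/-- The partition with no upper points determined by a word (a list of letters): two points
lie in the same block iff the corresponding letters coincide. -/
def wordPartition (w : List ℕ) : PartitionDiagram :=
  ofLabels (u := 0) (l := w.length) (Sum.elim (fun i => (i : ℕ)) fun j => w.get j)

/-- The canonical letter of the block of a lower point: the least index of a point in its
block. -/
noncomputable def blockLabel (p : PartitionDiagram) (j : Fin p.lower) : ℕ :=
  sInf { i : ℕ | ∃ h : i < p.lower, p.rel.r (Sum.inr ⟨i, h⟩) (Sum.inr j) }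

/-- The canonical word of a partition with no upper points. -/
noncomputable def canonWord (p : PartitionDiagram) : List ℕ :=
  List.ofFn fun j : Fin p.lower => blockLabel p j

/-- Full reduction of a word over an alphabet of involutions: repeatedly delete adjacent
equal pairs of letters.  This computes the result of iterating the operation replacing every
exponent in the run-decomposition of the word by its parity. -/
def reduceWord (w : List ℕ) : List ℕ :=
  w.foldr (fun x acc => match acc with
    | [] => [x]
    | y :: rest => if x = y then rest else x :: y :: rest) []

/-- The single leg version of a partition with no upper points: the unique partition in
single leg form obtained by iteratively replacing every exponent in its run-decomposition by
its parity. -/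
noncomputable def singleLegVersion (p : PartitionDiagram) : PartitionDiagram :=
  wordPartition (reduceWord (canonWord p))

namespace PartitionDiagram

theorem ofLabels_congr {u l : ℕ} {f g : Fin u ⊕ Fin l → ℕ}
    (h : ∀ x y, f x = f y ↔ g x = g y) : ofLabels f = ofLabels g := by
  have : Setoid.ker f = Setoid.ker g := Setoid.ext h
  simp only [ofLabels, this]

theorem mem_of_ofLabels_mem {M : Set PartitionDiagram} {u l : ℕ} {f g : Fin u ⊕ Fin l → ℕ}
    (h : ∀ x y, f x = f y ↔ g x = g y) (hg : ofLabels g ∈ M) : ofLabels f ∈ M :=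
  ofLabels_congr h ▸ hg

theorem splitPoint_map_castAdd {a b c d : ℕ} (x : Fin a ⊕ Fin c) :
    splitPoint (Sum.map (Fin.castAdd b) (Fin.castAdd d) x) = Sum.inl x := by
  cases x <;> simp [splitPoint]

theorem splitPoint_map_natAdd {a b c d : ℕ} (x : Fin b ⊕ Fin d) :
    splitPoint (Sum.map (Fin.natAdd a) (Fin.natAdd c) x) = Sum.inr x := by
  cases x <;> simp [splitPoint]

theorem exists_eq_map_castAdd_or_natAdd {a b c d : ℕ} (x : Fin (a + b) ⊕ Fin (c + d)) :
    (∃ y, x = Sum.map (Fin.castAdd b) (Fin.castAdd d) y) ∨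
      ∃ y, x = Sum.map (Fin.natAdd a) (Fin.natAdd c) y := by
  rcases x with i | j
  · refine Fin.addCases (fun i => Or.inl ⟨Sum.inl i, rfl⟩) (fun i => Or.inr ⟨Sum.inl i, rfl⟩) i
  · refine Fin.addCases (fun i => Or.inl ⟨Sum.inr i, rfl⟩) (fun i => Or.inr ⟨Sum.inr i, rfl⟩) j

/-- A labelling of the points of a tensor product determines the tensor product if it restricts
to labellings of both factors and uses disjoint sets of labels on them. -/
theorem tensor_ofLabels {a b c d : ℕ} {f : Fin a ⊕ Fin c → ℕ} {g : Fin b ⊕ Fin d → ℕ}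
    {e : Fin (a + b) ⊕ Fin (c + d) → ℕ}
    (hf : ∀ x y, e (Sum.map (Fin.castAdd b) (Fin.castAdd d) x) =
      e (Sum.map (Fin.castAdd b) (Fin.castAdd d) y) ↔ f x = f y)
    (hg : ∀ x y, e (Sum.map (Fin.natAdd a) (Fin.natAdd c) x) =
      e (Sum.map (Fin.natAdd a) (Fin.natAdd c) y) ↔ g x = g y)
    (hfg : ∀ x y, e (Sum.map (Fin.castAdd b) (Fin.castAdd d) x) ≠
      e (Sum.map (Fin.natAdd a) (Fin.natAdd c) y)) :
    tensor (ofLabels f) (ofLabels g) = ofLabels e := by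
  have : (Setoid.ker fun x : Fin (a + b) ⊕ Fin (c + d) =>
      Sum.map (Quotient.mk (Setoid.ker f)) (Quotient.mk (Setoid.ker g)) (splitPoint x)) =
      Setoid.ker e := by
    refine Setoid.ext fun x y => ?_
    change Sum.map (Quotient.mk (Setoid.ker f)) (Quotient.mk (Setoid.ker g)) (splitPoint x) =
      Sum.map (Quotient.mk (Setoid.ker f)) (Quotient.mk (Setoid.ker g)) (splitPoint y) ↔ e x = e y
    rcases exists_eq_map_castAdd_or_natAdd x with ⟨x, rfl⟩ | ⟨x, rfl⟩ <;>
    rcases exists_eq_map_castAdd_or_natAdd y with ⟨y, rfl⟩ | ⟨y, rfl⟩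
    · rw [splitPoint_map_castAdd, splitPoint_map_castAdd, hf]
      simp only [Sum.map_inl, Sum.inl.injEq]
      exact Quotient.eq
    · simp [splitPoint_map_castAdd, splitPoint_map_natAdd, hfg]
    · simp [splitPoint_map_castAdd, splitPoint_map_natAdd, (hfg _ _).symm]
    · rw [splitPoint_map_natAdd, splitPoint_map_natAdd, hg]
      simp only [Sum.map_inr, Sum.inr.injEq]
      exact Quotient.eq
  exact congrArg (PartitionDiagram.mk (a + b) (c + d)) this

/-- Labellings that agree on the middle row compose, provided every label of an outer point
occurs in the middle row. -/
theorem comp_ofLabels {u m l : ℕ} {F : Fin u → ℕ} {G : Fin m → ℕ} {H : Fin l → ℕ}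
    (hF : ∀ i, ∃ k, G k = F i) (hH : ∀ j, ∃ k, G k = H j) :
    comp (ofLabels (Sum.elim F G)) (ofLabels (Sum.elim G H)) rfl =
      ofLabels (Sum.elim F H) := by
  set p := ofLabels (Sum.elim F G)
  set q := ofLabels (Sum.elim G H)
  let R := Relation.EqvGen.setoid (compRel p q rfl)
  let L : Fin u ⊕ (Fin m ⊕ Fin l) → ℕ := Sum.elim F (Sum.elim G H)
  have hL : ∀ x y, R x y → L x = L y := by
    intro x y hxy
    induction hxy with
    | rel x y hxy =>
      rcases hxy with ⟨a, b, hab, rfl, rfl⟩ | ⟨a, b, hab, rfl, rfl⟩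
      · have hab' : Sum.elim F G a = Sum.elim F G b := hab
        rcases a with a | a <;> rcases b with b | b <;> exact hab'
      · have hab' : Sum.elim G H a = Sum.elim G H b := hab
        rcases a with a | a <;> rcases b with b | b <;> exact hab'
    | refl => rfl
    | symm _ _ _ ih => exact ih.symm
    | trans _ _ _ _ _ ih₁ ih₂ => exact ih₁.trans ih₂
  have hP : ∀ a b, Sum.elim F G a = Sum.elim F G b → R (iotaP p q a) (iotaP p q b) :=
    fun a b hab => Relation.EqvGen.rel _ _ (Or.inl ⟨a, b, hab, rfl, rfl⟩)
  have hQ : ∀ a b, Sum.elim G H a = Sum.elim G H b → R (iotaQ p q rfl a) (iotaQ p q rfl b) :=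
    fun a b hab => Relation.EqvGen.rel _ _ (Or.inr ⟨a, b, hab, rfl, rfl⟩)
  have hmid : ∀ x : Fin u ⊕ Fin l, ∃ k, G k = Sum.elim F H x ∧
      R (Sum.map id Sum.inr x) (Sum.inr (Sum.inl k)) := by
    rintro (i | j)
    · obtain ⟨k, hk⟩ := hF i
      exact ⟨k, hk, hP (Sum.inl i) (Sum.inr k) hk.symm⟩
    · obtain ⟨k, hk⟩ := hH j
      exact ⟨k, hk, hQ (Sum.inr j) (Sum.inl k) hk.symm⟩
  have : (comp p q rfl).rel = Setoid.ker (Sum.elim F H) := by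
    refine Setoid.ext fun x y => ?_
    change R (Sum.map id Sum.inr x) (Sum.map id Sum.inr y) ↔ Sum.elim F H x = Sum.elim F H y
    constructor
    · intro hxy
      have := hL _ _ hxy
      rcases x with x | x <;> rcases y with y | y <;> exact this
    · intro hxy
      obtain ⟨k, hk, hxk⟩ := hmid x
      obtain ⟨k', hk', hyk'⟩ := hmid y
      have hkk' : G k = G k' := hk.trans (hxy.trans hk'.symm)
      exact R.trans hxk (R.trans (hP (Sum.inr k) (Sum.inr k') hkk') (R.symm hyk'))
  exact congrArg (PartitionDiagram.mk u l) this

/-- The identity partition on `n` strands. -/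
def idStrands (n : ℕ) : PartitionDiagram :=
  ofLabels (u := n) (l := n) (Sum.elim Fin.val Fin.val)

/-- The partition in `P(n+2, n+2)` moving a pair of points, all in one four block, from the left
of `n` strands to their right. -/
def pairMover (n : ℕ) : PartitionDiagram :=
  ofLabels (u := n + 2) (l := n + 2)
    (Sum.elim (fun i => if (i : ℕ) < 2 then 0 else (i : ℕ) - 1)
      fun j => if (j : ℕ) < n then (j : ℕ) + 1 else 0)

theorem pairMover_one : pairMover 1 = pairPositioner := by
  refine ofLabels_congr ?_
  decide

theorem idStrands_one : idStrands 1 = idPartition := by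
  refine ofLabels_congr ?_
  decide

theorem tensor_idStrands_idPartition (n : ℕ) :
    tensor (idStrands n) idPartition = idStrands (n + 1) := by
  refine tensor_ofLabels ?_ ?_ ?_ <;> rintro (x | x) (y | y) <;> simp <;> omega

theorem comp_tensor_pairMover (n : ℕ) :
    comp (tensor (pairMover n) idPartition) (tensor (idStrands n) pairPositioner) rfl =
      pairMover (n + 1) := by
  let F : Fin (n + 2 + 1) → ℕ := fun i => if (i : ℕ) < 2 then 0 else (i : ℕ) - 1
  let G : Fin (n + 3) → ℕ := fun i =>
    if (i : ℕ) < n then (i : ℕ) + 1 else if (i : ℕ) < n + 2 then 0 else n + 1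
  let H : Fin (n + 3) → ℕ := fun j => if (j : ℕ) < n + 1 then (j : ℕ) + 1 else 0
  have hP : tensor (pairMover n) idPartition =
      ofLabels (u := n + 2 + 1) (l := n + 2 + 1) (Sum.elim F G) := by
    refine tensor_ofLabels ?_ ?_ ?_ <;> rintro (x | x) (y | y) <;> simp [F, G] <;> grind
  have hQ : tensor (idStrands n) pairPositioner =
      ofLabels (u := n + 3) (l := n + 3) (Sum.elim G H) := by
    refine tensor_ofLabels ?_ ?_ ?_ <;> rintro (x | x) (y | y) <;> simp [G, H] <;> grind
  have hG : ∀ v < n + 2, ∃ k, G k = v := by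
    intro v hv
    rcases Nat.eq_zero_or_pos v with rfl | hv0
    · exact ⟨⟨n, by omega⟩, by simp [G]⟩
    · rcases Nat.lt_or_ge v (n + 1) with h | h
      · exact ⟨⟨v - 1, by omega⟩, by simp only [G]; split_ifs <;> omega⟩
      · exact ⟨⟨n + 2, by omega⟩, by simp only [G]; split_ifs <;> omega⟩
  simp only [hP, hQ]
  refine (comp_ofLabels (fun i => hG _ ?_) fun j => hG _ ?_).trans rfl
  · simp only [F]; split_ifs <;> omega
  · simp only [H]; split_ifs <;> omega

theorem rotLU_ofLabels (F G : ℕ → ℕ) (u l : ℕ) (h : 0 < u) :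
    rotLU (ofLabels (u := u) (l := l) (Sum.elim (fun i => F i) fun j => G j)) h =
      ofLabels (u := u - 1) (l := l + 1)
        (Sum.elim (fun i => F (i + 1))
          fun j => if (j : ℕ) = 0 then F 0 else G (j - 1)) := by
  refine congrArg (PartitionDiagram.mk (u - 1) (l + 1)) (congrArg Setoid.ker (funext ?_))
  rintro (j | j)
  · rfl
  · by_cases hj : (j : ℕ) = 0
    · exact (congrArg (Sum.elim (fun i : Fin u => F i) fun j : Fin l => G j) (dif_pos hj)).trans
        (if_pos hj).symm
    · exact (congrArg (Sum.elim (fun i : Fin u => F i) fun j : Fin l => G j) (dif_neg hj)).trans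
        (if_neg hj).symm

theorem rotLD_ofLabels (F G : ℕ → ℕ) (u l : ℕ) (h : 0 < l) :
    rotLD (ofLabels (u := u) (l := l) (Sum.elim (fun i => F i) fun j => G j)) h =
      ofLabels (u := u + 1) (l := l - 1)
        (Sum.elim (fun i => if (i : ℕ) = 0 then G 0 else F (i - 1))
          fun j => G (j + 1)) := by
  refine congrArg (PartitionDiagram.mk (u + 1) (l - 1)) (congrArg Setoid.ker (funext ?_))
  rintro (j | j)
  · by_cases hj : (j : ℕ) = 0
    · exact (congrArg (Sum.elim (fun i : Fin u => F i) fun j : Fin l => G j) (dif_pos hj)).trans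
        (if_pos hj).symm
    · exact (congrArg (Sum.elim (fun i : Fin u => F i) fun j : Fin l => G j) (dif_neg hj)).trans
        (if_neg hj).symm
  · rfl

theorem rotRU_ofLabels (F G : ℕ → ℕ) (u l : ℕ) (h : 0 < u) :
    rotRU (ofLabels (u := u) (l := l) (Sum.elim (fun i => F i) fun j => G j)) h =
      ofLabels (u := u - 1) (l := l + 1)
        (Sum.elim (fun i => F i)
          fun j => if (j : ℕ) < l then G j else F (u - 1)) := by
  refine congrArg (PartitionDiagram.mk (u - 1) (l + 1)) (congrArg Setoid.ker (funext ?_))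
  rintro (j | j)
  · rfl
  · by_cases hj : (j : ℕ) < l
    · exact (congrArg (Sum.elim (fun i : Fin u => F i) fun j : Fin l => G j) (dif_pos hj)).trans
        (if_pos hj).symm
    · exact (congrArg (Sum.elim (fun i : Fin u => F i) fun j : Fin l => G j) (dif_neg hj)).trans
        (if_neg hj).symm

theorem rotRD_ofLabels (F G : ℕ → ℕ) (u l : ℕ) (h : 0 < l) :
    rotRD (ofLabels (u := u) (l := l) (Sum.elim (fun i => F i) fun j => G j)) h =
      ofLabels (u := u + 1) (l := l - 1)
        (Sum.elim (fun i => if (i : ℕ) < u then F i else G (l - 1))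
          fun j => G j) := by
  refine congrArg (PartitionDiagram.mk (u + 1) (l - 1)) (congrArg Setoid.ker (funext ?_))
  rintro (j | j)
  · by_cases hj : (j : ℕ) < u
    · exact (congrArg (Sum.elim (fun i : Fin u => F i) fun j : Fin l => G j) (dif_pos hj)).trans
        (if_pos hj).symm
    · exact (congrArg (Sum.elim (fun i : Fin u => F i) fun j : Fin l => G j) (dif_neg hj)).trans
        (if_neg hj).symm
  · rfl

end PartitionDiagram

theorem IsPartitionCategory.idStrands_mem {M : Set PartitionDiagram}
    (hM : IsPartitionCategory M) (n : ℕ) : idStrands (n + 1) ∈ M := by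
  induction n with
  | zero => exact idStrands_one ▸ hM.id_mem
  | succ n ih => exact tensor_idStrands_idPartition (n + 1) ▸ hM.tensor_mem _ ih _ hM.id_mem

theorem IsPartitionCategory.pairMover_mem {M : Set PartitionDiagram}
    (hM : IsPartitionCategory M) (h : pairPositioner ∈ M) (n : ℕ) : pairMover (n + 1) ∈ M := by
  induction n with
  | zero => exact pairMover_one ▸ h
  | succ n ih =>
    exact comp_tensor_pairMover (n + 1) ▸ hM.comp_mem _ (hM.tensor_mem _ ih _ hM.id_mem) _
      (hM.tensor_mem _ (hM.idStrands_mem n) _ h) rfl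

theorem IsPartitionCategory.kPart_mem_of_pairMover_mem {M : Set PartitionDiagram}
    (hM : IsPartitionCategory M) {n : ℕ} (h : pairMover n ∈ M) : kPart n ∈ M := by
  have h₁ := rotLU_ofLabels (fun i => if i < 2 then 0 else i - 1)
    (fun j => if j < n then j + 1 else 0) (n + 2) (n + 2) (Nat.succ_pos _) ▸
    hM.rotLU_mem _ h (Nat.succ_pos _)
  have h₂ := rotRD_ofLabels (fun i => if i + 1 < 2 then 0 else i + 1 - 1)
    (fun j => if j = 0 then if 0 < 2 then 0 else 0 - 1 else if j - 1 < n then j - 1 + 1 else 0)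
    (n + 1) (n + 3) (Nat.succ_pos _) ▸ hM.rotRD_mem _ h₁ (Nat.succ_pos _)
  refine mem_of_ofLabels_mem ?_ h₂
  rintro (⟨x, hx⟩ | ⟨x, hx⟩) (⟨y, hy⟩ | ⟨y, hy⟩) <;> simp <;> grind

theorem IsPartitionCategory.pairPositioner_mem_of_kPart_one_mem {M : Set PartitionDiagram}
    (hM : IsPartitionCategory M) (h : kPart 1 ∈ M) : pairPositioner ∈ M := by
  have h₀ : ofLabels (u := 3) (l := 3)
      (Sum.elim (fun i => (i : ℕ) % 2) fun j => (j : ℕ) % 2) ∈ M :=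
    mem_of_ofLabels_mem (by decide) h
  have h₁ := rotRU_ofLabels (fun i => i % 2) (fun j => j % 2) 3 3 (Nat.succ_pos _) ▸
    hM.rotRU_mem _ h₀ (Nat.succ_pos _)
  have h₂ := rotLD_ofLabels (fun i => i % 2) (fun j => if j < 3 then j % 2 else (3 - 1) % 2)
    2 4 (Nat.succ_pos _) ▸ hM.rotLD_mem _ h₁ (Nat.succ_pos _)
  exact mem_of_ofLabels_mem (by decide) h₂

/-- Let `C` be a category of partitions. Then the pair positioner partition `▷`
belongs to `C` if and only if `k_l` belongs to `C` for every `l ≥ 1`. -/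
theorem pairPositioner_mem_iff_kPart_mem (M : Set PartitionDiagram)
    (hM : IsPartitionCategory M) :
    pairPositioner ∈ M ↔ ∀ n : ℕ, 1 ≤ n → kPart n ∈ M := by
  constructor
  · rintro h (_ | n) hn
    · exact absurd hn (by omega)
    · exact hM.kPart_mem_of_pairMover_mem (hM.pairMover_mem h n)
  · exact fun h => hM.pairPositioner_mem_of_kPart_one_mem (h 1 le_rfl)
end

section
/- Let C be a group-theoretical category of partitions and let p ∈ C. Then every partition p' obtained from p by merging two of the blocks of p into a single block (leaving all other blocks unchanged) also belongs to C. -/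
open Classical

open PartitionDiagram

namespace PartitionDiagram

/-- The partition `p` is the one whose upper points carry the labels `x` and whose lower points
carry the labels `y`, blocks being the sets of equally labelled points. -/
def Represents (p : PartitionDiagram) (x y : List ℕ) : Prop :=
  p.upper = x.length ∧ p.lower = y.length ∧
    p.rel = Setoid.ker
      (Sum.elim (fun i : Fin p.upper => x.getD i 0) (fun j : Fin p.lower => y.getD j 0))

theorem Represents.unique {p q : PartitionDiagram} {x y : List ℕ}
    (hp : p.Represents x y) (hq : q.Represents x y) : p = q := by
  obtain ⟨u, l, r⟩ := p
  obtain ⟨u', l', r'⟩ := q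
  obtain ⟨rfl, rfl, h⟩ := hp
  obtain ⟨h1, h2, h'⟩ := hq
  dsimp only at h1 h2
  subst h1 h2
  dsimp only at h h'
  rw [h, h']

theorem represents_ofFn (p : PartitionDiagram) (g : Fin p.upper ⊕ Fin p.lower → ℕ)
    (hg : ∀ s t, p.rel s t ↔ g s = g t) :
    p.Represents (List.ofFn fun i => g (Sum.inl i)) (List.ofFn fun j => g (Sum.inr j)) := by
  refine ⟨by simp, by simp, ?_⟩
  ext s t
  rw [hg, Setoid.ker_def]
  have key : ∀ s, Sum.elim (fun i : Fin p.upper => (List.ofFn fun i => g (Sum.inl i)).getD i 0)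
      (fun j : Fin p.lower => (List.ofFn fun j => g (Sum.inr j)).getD j 0) s = g s := by
    rintro (i | j) <;> simp [List.getD]
  rw [key, key]

theorem Represents.map {p : PartitionDiagram} {x y : List ℕ} (hp : p.Represents x y)
    {f : ℕ → ℕ} (hf : Function.Injective f) : p.Represents (x.map f) (y.map f) := by
  obtain ⟨u, l, r⟩ := p
  obtain ⟨rfl, rfl, h⟩ := hp
  refine ⟨by simp, by simp, ?_⟩
  dsimp only at h ⊢
  rw [h]
  ext s t
  rw [Setoid.ker_def, Setoid.ker_def, ← hf.eq_iff]
  have key : ∀ s : Fin x.length ⊕ Fin y.length,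
      Sum.elim (fun i : Fin x.length => (x.map f).getD i 0)
      (fun j : Fin y.length => (y.map f).getD j 0) s =
      f (Sum.elim (fun i : Fin x.length => x.getD i 0) (fun j : Fin y.length => y.getD j 0) s) := by
    rintro (i | j) <;> simp [List.getD]
  rw [key, key]

theorem comap_ker_eq_ker {α β : Type*} {f : α → β} {g : β → ℕ} {g' : α → ℕ}
    (h : ∀ s, g (f s) = g' s) : Setoid.comap f (Setoid.ker g) = Setoid.ker g' := by
  obtain rfl : g ∘ f = g' := funext h
  rfl

theorem Represents.rotLU {p : PartitionDiagram} {a : ℕ} {x y : List ℕ}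
    (hp : p.Represents (a :: x) y) (h : 0 < p.upper) : (p.rotLU h).Represents x (a :: y) := by
  obtain ⟨u, l, r⟩ := p
  obtain ⟨rfl, rfl, hr⟩ := hp
  dsimp only at hr
  subst hr
  refine ⟨rfl, rfl, ?_⟩
  refine comap_ker_eq_ker fun s => ?_
  rcases s with i | j
  · change _ = x.getD i.1 0
    simp
  · change _ = (a :: y).getD j.1 0
    induction j using Fin.cases <;> simp

theorem Represents.rotLD {p : PartitionDiagram} {a : ℕ} {x y : List ℕ}
    (hp : p.Represents x (a :: y)) (h : 0 < p.lower) : (p.rotLD h).Represents (a :: x) y := by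
  obtain ⟨u, l, r⟩ := p
  obtain ⟨rfl, rfl, hr⟩ := hp
  dsimp only at hr
  subst hr
  refine ⟨rfl, rfl, ?_⟩
  refine comap_ker_eq_ker fun s => ?_
  rcases s with i | j
  · change _ = (a :: x).getD i.1 0
    induction i using Fin.cases <;> simp
  · change _ = y.getD j.1 0
    simp

theorem Represents.rotRU {p : PartitionDiagram} {a : ℕ} {y : List ℕ}
    (hp : p.Represents [a] y) (h : 0 < p.upper) : (p.rotRU h).Represents [] (y ++ [a]) := by
  obtain ⟨u, l, r⟩ := p
  obtain ⟨rfl, rfl, hr⟩ := hp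
  dsimp only at hr
  subst hr
  refine ⟨rfl, by simp [PartitionDiagram.rotRU], ?_⟩
  refine comap_ker_eq_ker fun s => ?_
  rcases s with i | j
  · exact i.elim0
  · change _ = (y ++ [a]).getD j.1 0
    induction j using Fin.lastCases <;> simp [List.getD]

theorem Represents.tensor {p q : PartitionDiagram} {v w : List ℕ}
    (hp : p.Represents [] v) (hq : q.Represents [] w) (hvw : v.Disjoint w) :
    (p.tensor q).Represents [] (v ++ w) := by
  obtain ⟨u, l, r⟩ := p
  obtain ⟨u', l', r'⟩ := q
  obtain ⟨rfl, rfl, hr⟩ := hp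
  dsimp only at hr
  subst hr
  obtain ⟨rfl, rfl, hr⟩ := hq
  dsimp only at hr
  subst hr
  have hne : ∀ (i : Fin v.length) (j : Fin w.length), v[i] ≠ w[j] := fun i j h =>
    hvw (List.getElem_mem i.2) (h ▸ List.getElem_mem j.2)
  refine ⟨rfl, by simp [PartitionDiagram.tensor], ?_⟩
  ext s t
  rcases s with s | s
  · exact s.elim0
  rcases t with t | t
  · exact t.elim0
  change Fin (v.length + w.length) at s t
  change Sum.map (Quotient.mk _) (Quotient.mk _) (splitPoint _) =
    Sum.map (Quotient.mk _) (Quotient.mk _) (splitPoint _) ↔ (v ++ w).getD s 0 = (v ++ w).getD t 0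
  induction s using Fin.addCases <;> induction t using Fin.addCases <;>
    simp [splitPoint, Quotient.eq, Setoid.ker_def, List.getD,
      List.getElem?_append_left (Fin.isLt _)]
  · exact hne _ _
  · exact (hne _ _).symm

theorem Represents.comp_cap {p : PartitionDiagram} {x : List ℕ} {c d : ℕ}
    (hp : p.Represents x [d, c]) (h : p.lower = pairPartition.invol.upper) :
    (p.comp pairPartition.invol h).Represents
      (x.map fun k => if k = d then c else k) [] := by
  obtain ⟨u, l, r⟩ := p
  obtain ⟨rfl, rfl, hr⟩ := hp
  dsimp only at hr
  refine ⟨by simp [comp], rfl, ?_⟩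
  ext s t
  rcases s with s | s
  swap
  · exact s.elim0
  rcases t with t | t
  swap
  · exact t.elim0
  change Fin x.length at s t
  set C := compRel ⟨x.length, [d, c].length, r⟩ pairPartition.invol h
  have up : ∀ a b, r a b → Relation.EqvGen C (iotaP _ _ a) (iotaP _ _ b) := fun a b hab =>
    .rel _ _ (Or.inl ⟨a, b, hab, rfl, rfl⟩)
  have mid : Relation.EqvGen C (Sum.inr (Sum.inl (0 : Fin 2))) (Sum.inr (Sum.inl (1 : Fin 2))) :=
    .rel _ _ (Or.inr ⟨Sum.inl (0 : Fin 2), Sum.inl (1 : Fin 2), rfl, rfl, rfl⟩)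
  have hd : ∀ i : Fin x.length, x[i] = d →
      Relation.EqvGen C (Sum.inl i) (Sum.inr (Sum.inl (0 : Fin 2))) := fun i hi =>
    up (Sum.inl i) (Sum.inr (0 : Fin 2)) (by rw [hr, Setoid.ker_def]; simpa using hi)
  have hc : ∀ i : Fin x.length, x[i] = c →
      Relation.EqvGen C (Sum.inl i) (Sum.inr (Sum.inl (0 : Fin 2))) := fun i hi =>
    (up (Sum.inl i) (Sum.inr (1 : Fin 2)) (by rw [hr, Setoid.ker_def]; simpa using hi)).trans
      _ _ _ mid.symm
  have hiff : Relation.EqvGen C (Sum.inl s) (Sum.inl t) ↔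
      (if x[s] = d then c else x[s]) = (if x[t] = d then c else x[t]) := by
    constructor
    · let G : Fin x.length ⊕ (Fin 2 ⊕ Fin 0) → ℕ :=
        Sum.elim (fun i => if x[i] = d then c else x[i]) fun _ => c
      intro H
      suffices hG : ∀ a b, Relation.EqvGen C a b → G a = G b from hG _ _ H
      intro a b H
      induction H with
      | rel a b hab =>
        rcases hab with ⟨a, b, hab, rfl, rfl⟩ | ⟨a, b, -, rfl, rfl⟩
        · have hval : ∀ a : Fin x.length ⊕ Fin 2, G (Sum.map id Sum.inl a) =
              (fun k => if k = d then c else k)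
                (Sum.elim (fun i : Fin x.length => x.getD i 0)
                  (fun j : Fin 2 => [d, c].getD j 0) a) := by
            rintro (i | j)
            · simp [G]
            · fin_cases j <;> simp [G]
          change r a b at hab
          rw [hr, Setoid.ker_def] at hab
          exact (hval a).trans ((congrArg (fun k => if k = d then c else k) hab).trans (hval b).symm)
        · rfl
      | refl => rfl
      | symm _ _ _ ih => exact ih.symm
      | trans _ _ _ _ _ ih₁ ih₂ => exact ih₁.trans ih₂
    · intro H
      split_ifs at H with h₁ h₂ h₂
      · exact (hd s h₁).trans _ _ _ (hd t h₂).symm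
      · exact (hd s h₁).trans _ _ _ (hc t H.symm).symm
      · exact (hc s H).trans _ _ _ (hd t h₂).symm
      · exact up (Sum.inl s) (Sum.inl t) (by rw [hr, Setoid.ker_def]; simpa using H)
  refine Iff.trans hiff ?_
  change _ ↔ (x.map fun k => if k = d then c else k).getD s 0 =
    (x.map fun k => if k = d then c else k).getD t 0
  simp [List.getD]

end PartitionDiagram

/-- The set of partitions `M` contains the partition represented by `x` and `y`. -/
def ContainsWords (M : Set PartitionDiagram) (x y : List ℕ) : Prop :=
  ∃ p ∈ M, p.Represents x y

namespace IsPartitionCategory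

variable {M : Set PartitionDiagram}

theorem containsWords_cons_left (hM : IsPartitionCategory M) {a : ℕ} {x y : List ℕ} :
    ContainsWords M (a :: x) y ↔ ContainsWords M x (a :: y) := by
  constructor
  · rintro ⟨p, hp, h⟩
    have h0 : 0 < p.upper := by simp [h.1]
    exact ⟨_, hM.rotLU_mem p hp h0, h.rotLU h0⟩
  · rintro ⟨p, hp, h⟩
    have h0 : 0 < p.lower := by simp [h.2.1]
    exact ⟨_, hM.rotLD_mem p hp h0, h.rotLD h0⟩

theorem containsWords_reverse_append (hM : IsPartitionCategory M) {v x y : List ℕ} :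
    ContainsWords M x (v ++ y) ↔ ContainsWords M (v.reverse ++ x) y := by
  induction v generalizing x with
  | nil => rfl
  | cons a v ih =>
    rw [List.cons_append, ← hM.containsWords_cons_left, ih]
    simp

theorem containsWords_append_comm (hM : IsPartitionCategory M) {v w : List ℕ}
    (h : ContainsWords M [] (v ++ w)) : ContainsWords M [] (w ++ v) := by
  induction v generalizing w with
  | nil => simpa using h
  | cons a v ih =>
    obtain ⟨p, hp, h⟩ := hM.containsWords_cons_left.2 h
    have h0 : 0 < p.upper := by simp [h.1]
    have := ih (w := w ++ [a]) (by
      rw [← List.append_assoc]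
      exact ⟨_, hM.rotRU_mem p hp h0, h.rotRU h0⟩)
    simpa using this

/-- Contracting two neighbouring points merges their blocks. -/
theorem containsWords_contract (hM : IsPartitionCategory M) {v w : List ℕ} {c d : ℕ}
    (h : ContainsWords M [] (v ++ d :: c :: w)) :
    ContainsWords M [] ((v ++ w).map fun k => if k = d then c else k) := by
  have h₁ : ContainsWords M [] ((w ++ v) ++ [d, c]) := by
    have := hM.containsWords_append_comm (v := v ++ [d, c]) (w := w) (by simpa using h)
    simpa using this
  obtain ⟨p, hp, hr⟩ := hM.containsWords_reverse_append.1 h₁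
  have hl : p.lower = pairPartition.invol.upper := hr.2.1
  have h₂ : ContainsWords M _ [] :=
    ⟨_, hM.comp_mem p hp _ (hM.invol_mem _ hM.pair_mem) hl, hr.comp_cap hl⟩
  rw [List.append_nil, List.map_reverse, ← List.append_nil (List.reverse _),
    ← hM.containsWords_reverse_append, List.append_nil, List.map_append] at h₂
  rw [List.map_append]
  exact hM.containsWords_append_comm h₂

theorem containsWords_tensor (hM : IsPartitionCategory M) {v w : List ℕ} {f : ℕ → ℕ}
    (hf : Function.Injective f) (hv : ContainsWords M [] v) (hw : ContainsWords M [] w)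
    (hvw : (v.map f).Disjoint w) : ContainsWords M [] (v.map f ++ w) := by
  obtain ⟨p, hp, hpv⟩ := hv
  obtain ⟨q, hq, hqw⟩ := hw
  exact ⟨_, hM.tensor_mem p hp q hq, (hpv.map hf).tensor hqw hvw⟩

end IsPartitionCategory

theorem exists_fresh_letter (w : List ℕ) : ∃ s : ℕ, ∀ k ∈ w, k < s :=
  ⟨w.sum + 1, fun _ hk => Nat.lt_succ_of_le (List.le_sum_of_mem hk)⟩

theorem map_ite_eq_self {c d : ℕ} {w : List ℕ} (hd : d ∉ w) :
    (w.map fun k => if k = d then c else k) = w := by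
  refine (List.map_congr_left fun k hk => if_neg ?_).trans (List.map_id w)
  rintro rfl
  exact hd hk

theorem map_ite_self (c : ℕ) (w : List ℕ) : (w.map fun k => if k = c then c else k) = w := by
  refine (List.map_congr_left fun k _ => ?_).trans (List.map_id w)
  split_ifs with h
  · exact h.symm
  · rfl

namespace IsGroupTheoreticalCategory

variable {M : Set PartitionDiagram}

theorem containsWords_pairPositioner (hM : IsGroupTheoreticalCategory M) :
    ContainsWords M [] [1, 0, 0, 1, 0, 0] := by
  have h : pairPositioner.Represents [0, 0, 1] [1, 0, 0] := by
    refine ⟨rfl, rfl, ?_⟩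
    change Setoid.ker _ = Setoid.ker _
    congr 1
    funext s
    rcases s with i | j
    · change Fin 3 at i
      fin_cases i <;> rfl
    · change Fin 3 at j
      fin_cases j <;> rfl
  exact (hM.1.containsWords_reverse_append (v := [1, 0, 0]) (x := []) (y := [1, 0, 0])).2
    ⟨_, hM.2, h⟩

theorem containsWords_fourBlock (hM : IsGroupTheoreticalCategory M) :
    ContainsWords M [] [0, 0, 0, 0] :=
  hM.1.containsWords_contract (v := []) (w := [0, 1, 0, 0]) hM.containsWords_pairPositioner

theorem containsWords_triple (hM : IsGroupTheoreticalCategory M) {a : ℕ} {w : List ℕ}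
    (h : ContainsWords M [] (a :: w)) : ContainsWords M [] (a :: a :: a :: w) := by
  obtain ⟨s, hs⟩ := exists_fresh_letter (a :: w)
  have hsw : s ∉ w := fun hk => lt_irrefl s (hs s (List.mem_cons_of_mem _ hk))
  have h₁ := hM.1.containsWords_tensor (add_left_injective s) hM.containsWords_fourBlock h (by
    intro k hk hk'
    have := hs k hk'
    simp at hk
    omega)
  have h₂ := hM.1.containsWords_contract (v := [s, s, s]) (d := s) (c := a) (w := w)
    (by simpa using h₁)
  simpa [map_ite_eq_self hsw] using h₂

/-- A pair of equal neighbouring letters can be moved past one letter. -/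
theorem containsWords_swap_pair (hM : IsGroupTheoreticalCategory M) {a b : ℕ} {w : List ℕ}
    (h : ContainsWords M [] (a :: a :: b :: w)) : ContainsWords M [] (b :: a :: a :: w) := by
  obtain ⟨s, hs⟩ := exists_fresh_letter (a :: a :: b :: w)
  have hsw : s ∉ w := fun hk => lt_irrefl s (hs s (by simp [hk]))
  have hsw' : s + 1 ∉ w := fun hk => by
    have := hs (s + 1) (by simp [hk])
    omega
  have ha : a < s := hs a (by simp)
  have hb : b < s := hs b (by simp)
  have h₁ := hM.1.containsWords_tensor (add_left_injective s) hM.containsWords_pairPositioner h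
    (by
      intro k hk hk'
      have := hs k hk'
      simp at hk
      omega)
  have h₂ := hM.1.containsWords_contract (v := [s + 1, s, s, s + 1, s]) (d := s) (c := a)
    (w := a :: b :: w) (by simpa [add_comm] using h₁)
  have h₃ := hM.1.containsWords_contract (v := [s + 1, a, a, s + 1]) (d := a) (c := a)
    (w := b :: w) (by simpa [map_ite_eq_self hsw, ha.ne, hb.ne] using h₂)
  rw [map_ite_self] at h₃
  have h₄ := hM.1.containsWords_contract (v := [s + 1, a, a]) (d := s + 1) (c := b)
    (w := w) (by simpa using h₃)
  simpa [map_ite_eq_self hsw', (ha.trans s.lt_succ_self).ne] using h₄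

theorem containsWords_move_pair (hM : IsGroupTheoreticalCategory M) {a : ℕ} {v w : List ℕ}
    (h : ContainsWords M [] (a :: a :: (v ++ w))) : ContainsWords M [] (v ++ a :: a :: w) := by
  induction v generalizing w with
  | nil => exact h
  | cons b v ih =>
    have h₁ := hM.1.containsWords_append_comm (v := [b]) (hM.containsWords_swap_pair h)
    have h₂ := ih (w := w ++ [b]) (by simpa using h₁)
    have h₃ := hM.1.containsWords_append_comm (v := v ++ a :: a :: w) (w := [b]) (by simpa using h₂)
    simpa using h₃

theorem containsWords_merge_cons (hM : IsGroupTheoreticalCategory M) {c d : ℕ} {w : List ℕ}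
    (h : ContainsWords M [] (d :: w)) (hc : c ∈ w) :
    ContainsWords M [] ((d :: w).map fun k => if k = d then c else k) := by
  obtain ⟨v, t, rfl⟩ := List.append_of_mem hc
  have h₁ := hM.containsWords_move_pair (v := d :: v) (w := c :: t) (hM.containsWords_triple h)
  have h₂ := hM.1.containsWords_contract (v := d :: v ++ [d]) (d := d) (c := c) (w := t)
    (by simpa using h₁)
  simpa using h₂

/-- Identifying two letters of a word. -/
theorem containsWords_merge (hM : IsGroupTheoreticalCategory M) {c d : ℕ} {x y : List ℕ}
    (h : ContainsWords M x y) (hc : c ∈ x ++ y) (hd : d ∈ x ++ y) :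
    ContainsWords M (x.map fun k => if k = d then c else k)
      (y.map fun k => if k = d then c else k) := by
  obtain rfl | hcd := eq_or_ne d c
  · simpa only [map_ite_self] using h
  have h₁ : ContainsWords M [] (x.reverse ++ y) := by
    rw [hM.1.containsWords_reverse_append]
    simpa using h
  obtain ⟨v, w, hvw⟩ := List.append_of_mem (show d ∈ x.reverse ++ y by simpa using hd)
  have hc' : c ∈ x.reverse ++ y := by simpa using hc
  rw [hvw] at h₁ hc'
  have h₂ := hM.containsWords_merge_cons (c := c) (w := w ++ v)
    (by simpa using hM.1.containsWords_append_comm h₁)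
    (by
      simp only [List.mem_append, List.mem_cons, hcd.symm, false_or] at hc' ⊢
      exact hc'.symm)
  rw [← List.cons_append, List.map_append] at h₂
  have h₃ := hM.1.containsWords_append_comm h₂
  rw [← List.map_append, ← hvw, List.map_append, hM.1.containsWords_reverse_append] at h₃
  simpa using h₃

end IsGroupTheoreticalCategory

/-- Let `C` be a group-theoretical category of partitions and `p ∈ C`. Then every
partition obtained from `p` by merging two of its blocks into a single block also belongs
to `C`. -/
theorem mergeBlocks_mem (M : Set PartitionDiagram) (hM : IsGroupTheoreticalCategory M)
    (p : PartitionDiagram) (hp : p ∈ M) (a b : Fin p.upper ⊕ Fin p.lower) :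
    PartitionDiagram.mergeBlocks p a b ∈ M := by
  obtain ⟨f, hf⟩ := exists_injective_nat (Quotient p.rel)
  let g : Fin p.upper ⊕ Fin p.lower → ℕ := fun s => f (Quotient.mk p.rel s)
  have hg : ∀ s t, p.rel s t ↔ g s = g t := fun s t => by
    rw [hf.eq_iff, Quotient.eq]
  have hmem : ∀ s, g s ∈ (List.ofFn fun i => g (Sum.inl i)) ++
      List.ofFn fun j => g (Sum.inr j) := by
    rintro (i | j) <;> simp [List.mem_ofFn]
  obtain ⟨q, hq, hqr⟩ := hM.containsWords_merge ⟨p, hp, p.represents_ofFn g hg⟩ (hmem a) (hmem b)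
  suffices h : (p.mergeBlocks a b).Represents
      ((List.ofFn fun i => g (Sum.inl i)).map fun k => if k = g b then g a else k)
      ((List.ofFn fun j => g (Sum.inr j)).map fun k => if k = g b then g a else k) from
    h.unique hqr ▸ hq
  rw [List.map_ofFn, List.map_ofFn]
  refine (p.mergeBlocks a b).represents_ofFn (fun s => if g s = g b then g a else g s) ?_
  intro (s : Fin p.upper ⊕ Fin p.lower) (t : Fin p.upper ⊕ Fin p.lower)
  change (if p.rel s a ∨ p.rel s b then none else some (Quotient.mk p.rel s)) =
    (if p.rel t a ∨ p.rel t b then none else some (Quotient.mk p.rel t)) ↔ _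
  simp only [hg]
  have hst : Quotient.mk p.rel s = Quotient.mk p.rel t ↔ g s = g t := by rw [hf.eq_iff]
  by_cases h₁ : g s = g b <;> by_cases h₂ : g t = g b <;>
    by_cases h₃ : g s = g a <;> by_cases h₄ : g t = g a <;> simp_all [eq_comm]
end

section
/- Let C be a group-theoretical category of partitions. A partition p ∈ P(0,n) with no upper points belongs to C if and only if its single leg version belongs to C. -/
open Classical

open PartitionDiagram

namespace PartitionDiagram

/-- The partition with upper word `u` and lower word `w`, both read from left to right: two
points lie in the same block iff the corresponding letters coincide. -/
def ofWords (u w : List ℕ) : PartitionDiagram :=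
  ofLabels (u := u.length) (l := w.length)
    (Sum.elim (fun i => u.getD i 0) fun j => w.getD j 0)

theorem eq_ofWords (p : PartitionDiagram) (u w : List ℕ) (hu : p.upper = u.length)
    (hw : p.lower = w.length) (f : Fin p.upper ⊕ Fin p.lower → ℕ)
    (hf : ∀ x y, p.rel x y ↔ f x = f y)
    (hfu : ∀ i, f (Sum.inl i) = u.getD i 0) (hfw : ∀ j, f (Sum.inr j) = w.getD j 0) :
    p = ofWords u w := by
  obtain ⟨m, n, r⟩ := p
  dsimp only at hu hw
  subst hu hw
  have hfe : f = Sum.elim (fun i : Fin u.length => u.getD i 0)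
      fun j : Fin w.length => w.getD j 0 := by
    ext x
    rcases x with x | x
    · exact hfu x
    · exact hfw x
  subst hfe
  unfold ofWords ofLabels
  congr 1
  ext x y
  exact hf x y

theorem wordPartition_eq_ofWords (w : List ℕ) : wordPartition w = ofWords [] w := by
  refine eq_ofWords _ _ _ rfl rfl _ (fun _ _ => Iff.rfl) (fun i => i.elim0) fun j => ?_
  have hj : (j : ℕ) < w.length := j.isLt
  exact (List.getD_eq_getElem _ _ hj).symm

theorem rotRD_ofWords (u w : List ℕ) (a : ℕ) (h : 0 < (ofWords u (w ++ [a])).lower) :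
    rotRD (ofWords u (w ++ [a])) h = ofWords (u ++ [a]) w := by
  refine eq_ofWords _ _ _ (by simp [rotRD, ofWords, ofLabels])
    (by simp [rotRD, ofWords, ofLabels]) _ (fun _ _ => Iff.rfl) (fun i => ?_) fun j => ?_
  · have hi : (i : ℕ) < u.length + 1 := i.isLt
    by_cases hiu : (i : ℕ) < u.length
    · simp [ofWords, ofLabels, hiu, List.getElem?_append_left]
    · have : (i : ℕ) = u.length := by omega
      simp [ofWords, ofLabels, this]
  · have hj : (j : ℕ) < w.length := by
      have := j.isLt
      simpa [rotRD, ofWords, ofLabels] using this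
    exact List.getD_append _ _ _ _ hj

theorem rotRU_ofWords (u w : List ℕ) (a : ℕ) (h : 0 < (ofWords (u ++ [a]) w).upper) :
    rotRU (ofWords (u ++ [a]) w) h = ofWords u (w ++ [a]) := by
  refine eq_ofWords _ _ _ (by simp [rotRU, ofWords, ofLabels])
    (by simp [rotRU, ofWords, ofLabels]) _ (fun _ _ => Iff.rfl) (fun j => ?_) fun i => ?_
  · have hj : (j : ℕ) < u.length := by
      have := j.isLt
      simpa [rotRU, ofWords, ofLabels] using this
    exact List.getD_append _ _ _ _ hj
  · have hi : (i : ℕ) < w.length + 1 := i.isLt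
    by_cases hiw : (i : ℕ) < w.length
    · simp [ofWords, ofLabels, hiw, List.getElem?_append_left]
    · have : (i : ℕ) = w.length := by omega
      simp [ofWords, ofLabels, this]

theorem rotLU_ofWords (u w : List ℕ) (a : ℕ) (h : 0 < (ofWords (a :: u) w).upper) :
    rotLU (ofWords (a :: u) w) h = ofWords u (a :: w) := by
  refine eq_ofWords _ _ _ (by simp [rotLU, ofWords, ofLabels])
    (by simp [rotLU, ofWords, ofLabels]) _ (fun _ _ => Iff.rfl) (fun _ => rfl) ?_
  rintro ⟨i, hi⟩
  cases i <;> rfl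

theorem comp_ofWords (u v w : List ℕ) (huw : ∀ a ∈ u, a ∈ w → a ∈ v) :
    comp (ofWords u v) (ofWords v w) rfl = ofWords u w := by
  refine eq_ofWords _ _ _ rfl rfl
    (Sum.elim (fun i => u.getD i 0) fun j => w.getD j 0) ?_ (fun _ => rfl) fun _ => rfl
  have getD_mem : ∀ (l : List ℕ) (i : Fin l.length), l.getD i 0 ∈ l := fun l i => by
    simp
  have join : ∀ x y, Relation.EqvGen (compRel (ofWords u v) (ofWords v w) rfl) x y →
      Sum.elim (fun i : Fin u.length => u.getD i 0) (Sum.elim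
        (fun i : Fin v.length => v.getD i 0) fun j : Fin w.length => w.getD j 0) x =
      Sum.elim (fun i : Fin u.length => u.getD i 0) (Sum.elim
        (fun i : Fin v.length => v.getD i 0) fun j : Fin w.length => w.getD j 0) y := by
    intro x y hxy
    induction hxy with
    | rel x y hxy =>
      rcases hxy with ⟨a, b, hab, rfl, rfl⟩ | ⟨a, b, hab, rfl, rfl⟩
      · rcases a with a | a <;> rcases b with b | b <;> exact hab
      · rcases a with a | a <;> rcases b with b | b <;> exact hab
    | refl x => rfl
    | symm x y _ ih => exact ih.symm
    | trans x y z _ _ ih₁ ih₂ => exact ih₁.trans ih₂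
  have mixed : ∀ (i : Fin u.length) (j : Fin w.length), u.getD i 0 = w.getD j 0 →
      Relation.EqvGen (compRel (ofWords u v) (ofWords v w) rfl) (Sum.inl i)
        (Sum.inr (Sum.inr j)) := by
    intro i j hij
    obtain ⟨l, hl, hlv⟩ := List.getElem_of_mem
      (huw _ (getD_mem u i) (hij ▸ getD_mem w j))
    have hlD : v.getD l 0 = u.getD i 0 := by rw [List.getD_eq_getElem _ _ hl, hlv]
    refine .trans _ (Sum.inr (Sum.inl ⟨l, hl⟩)) _ (.rel _ _ (.inl ?_)) (.rel _ _ (.inr ?_))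
    · exact ⟨Sum.inl i, Sum.inr ⟨l, hl⟩, hlD.symm, rfl, rfl⟩
    · exact ⟨Sum.inl ⟨l, hl⟩, Sum.inr j, hlD.trans hij, rfl, rfl⟩
  rintro (i | i) (j | j)
  · exact ⟨join (Sum.inl i) (Sum.inl j),
      fun h => .rel _ _ (.inl ⟨Sum.inl i, Sum.inl j, h, rfl, rfl⟩)⟩
  · exact ⟨join (Sum.inl i) (Sum.inr (Sum.inr j)), mixed i j⟩
  · exact ⟨join (Sum.inr (Sum.inr i)) (Sum.inl j), fun h => .symm _ _ (mixed j i h.symm)⟩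
  · exact ⟨join (Sum.inr (Sum.inr i)) (Sum.inr (Sum.inr j)),
      fun h => .rel _ _ (.inr ⟨Sum.inr i, Sum.inr j, h, rfl, rfl⟩)⟩

theorem pairPartition_eq_ofWords (a : ℕ) : pairPartition = ofWords [] [a, a] := by
  refine eq_ofWords _ _ _ rfl rfl (fun _ => a)
    (fun _ _ => iff_of_true rfl rfl) (fun i => i.elim0) fun j => ?_
  change Fin 2 at j
  fin_cases j <;> rfl

theorem pairPositioner_eq_ofWords {a b : ℕ} (hab : a ≠ b) :
    pairPositioner = ofWords [a, a, b] [b, a, a] := by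
  refine eq_ofWords _ _ _ rfl rfl (Sum.elim
    (fun i => if (i : ℕ) = 2 then b else a) fun j => if (j : ℕ) = 0 then b else a)
    ?_ (fun i => ?_) fun j => ?_
  · have hba := hab.symm
    rintro (x | x) (y | y) <;> change (ite _ _ _ = ite _ _ _) ↔ _ <;>
      simp only [Sum.elim_inl, Sum.elim_inr] <;> split_ifs <;> simp [*]
  · change Fin 3 at i
    fin_cases i <;> rfl
  · change Fin 3 at j
    fin_cases j <;> rfl

/-- Capping off the lower row `b a` merges all blocks of a partition on the letters `a, b`. -/
theorem comp_ofWords_pair {a b : ℕ} (c : ℕ) (u : List ℕ) (hu : ∀ x ∈ u, x = a ∨ x = b) :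
    comp (ofWords u [b, a]) (ofWords [c, c] []) rfl = ofWords (u.map fun _ => c) [] := by
  refine eq_ofWords _ _ _ (by simp [comp, ofWords, ofLabels]) rfl (fun _ => c) ?_ (fun i => ?_)
    fun j => j.elim0
  · have base : ∀ i : Fin u.length, Relation.EqvGen
        (compRel (ofWords u [b, a]) (ofWords [c, c] []) rfl) (Sum.inl i)
          (Sum.inr (Sum.inl (0 : Fin 2))) := by
      intro i
      have hi : u.getD i 0 ∈ u := by simp
      rcases hu _ hi with h | h
      · refine .trans _ (Sum.inr (Sum.inl (1 : Fin 2))) _ (.rel _ _ (.inl ?_))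
          (.rel _ _ (.inr ?_))
        · exact ⟨Sum.inl i, Sum.inr (1 : Fin 2), h, rfl, rfl⟩
        · exact ⟨Sum.inl (1 : Fin 2), Sum.inl (0 : Fin 2), rfl, rfl, rfl⟩
      · exact .rel _ _ (.inl ⟨Sum.inl i, Sum.inr (0 : Fin 2), h, rfl, rfl⟩)
    rintro (i | i) (j | j)
    · exact iff_of_true (.trans _ _ _ (base i) (.symm _ _ (base j))) rfl
    · exact j.elim0
    · exact i.elim0
    · exact i.elim0
  · have hi : (i : ℕ) < u.length := i.isLt
    simp [hi]

theorem eq_wordPartition_canonWord (p : PartitionDiagram) (hp : p.upper = 0) :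
    p = wordPartition (canonWord p) := by
  rw [wordPartition_eq_ofWords]
  refine eq_ofWords _ _ _ hp (by simp [canonWord]) (Sum.elim (fun _ => 0) (blockLabel p)) ?_
    (fun i => (Fin.cast hp i).elim0) fun j => by simp [canonWord]
  have spec : ∀ j, ∃ h : blockLabel p j < p.lower,
      p.rel (Sum.inr ⟨blockLabel p j, h⟩) (Sum.inr j) := fun j =>
    Nat.sInf_mem (s := { i : ℕ | ∃ h : i < p.lower, p.rel.r (Sum.inr ⟨i, h⟩) (Sum.inr j) })
      ⟨j, j.isLt, p.rel.refl _⟩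
  rintro (i | i) (j | j)
  · exact (Fin.cast hp i).elim0
  · exact (Fin.cast hp i).elim0
  · exact (Fin.cast hp j).elim0
  · constructor
    · intro hij
      change blockLabel p i = blockLabel p j
      unfold blockLabel
      congr 1
      ext k
      exact ⟨fun ⟨h, hk⟩ => ⟨h, p.rel.trans hk hij⟩,
        fun ⟨h, hk⟩ => ⟨h, p.rel.trans hk (p.rel.symm hij)⟩⟩
    · intro hij
      change blockLabel p i = blockLabel p j at hij
      obtain ⟨hi, hpi⟩ := spec i
      obtain ⟨hj, hpj⟩ := spec j
      simp only [hij] at hpi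
      exact p.rel.trans (p.rel.symm hpi) hpj

end PartitionDiagram

namespace IsPartitionCategory

variable {M : Set PartitionDiagram}

theorem rotate_down (hM : IsPartitionCategory M) {u w : List ℕ} {a : ℕ}
    (h : ofWords (u ++ [a]) w ∈ M) : ofWords u (w ++ [a]) ∈ M := by
  rw [← rotRU_ofWords u w a (by simp [ofWords, ofLabels])]
  exact hM.rotRU_mem _ h _

theorem rotate_up (hM : IsPartitionCategory M) {u w : List ℕ} {a : ℕ}
    (h : ofWords u (w ++ [a]) ∈ M) : ofWords (u ++ [a]) w ∈ M := by
  rw [← rotRD_ofWords u w a (by simp [ofWords, ofLabels])]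
  exact hM.rotRD_mem _ h _

theorem ofWords_append_mem_iff (hM : IsPartitionCategory M) (v : List ℕ) :
    ∀ u w, ofWords u (w ++ v) ∈ M ↔ ofWords (u ++ v.reverse) w ∈ M := by
  induction v with
  | nil => simp
  | cons a v ih =>
    intro u w
    have := ih u (w ++ [a])
    rw [List.append_assoc, List.singleton_append] at this
    rw [this, List.reverse_cons, ← List.append_assoc]
    exact ⟨hM.rotate_up, hM.rotate_down⟩

theorem append_comm_mem (hM : IsPartitionCategory M) (v : List ℕ) :
    ∀ u, ofWords [] (u ++ v) ∈ M → ofWords [] (v ++ u) ∈ M := by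
  induction v using List.reverseRecOn with
  | nil => simp
  | append_singleton v a ih =>
    intro u h
    rw [← List.append_assoc] at h
    have h' := hM.rotLU_mem _ (hM.rotate_up h) (by simp [ofWords, ofLabels])
    simp only [List.nil_append] at h'
    rw [rotLU_ofWords] at h'
    simpa using ih (a :: u) h'

theorem append_comm_mem_iff (hM : IsPartitionCategory M) (u v : List ℕ) :
    ofWords [] (u ++ v) ∈ M ↔ ofWords [] (v ++ u) ∈ M :=
  ⟨hM.append_comm_mem v u, hM.append_comm_mem u v⟩

/-- Applying a partition of the category to an initial segment of a word. -/
theorem replace_prefix_mem (hM : IsPartitionCategory M) {u v w : List ℕ}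
    (huv : ofWords u v ∈ M) (hw : ∀ a ∈ w, a ∈ v → a ∈ u)
    (h : ofWords [] (u ++ w) ∈ M) : ofWords [] (v ++ w) ∈ M := by
  rw [hM.ofWords_append_mem_iff, List.nil_append] at h ⊢
  rw [← comp_ofWords w.reverse u v fun a ha => hw a (List.mem_reverse.1 ha)]
  exact hM.comp_mem _ h _ huv rfl

theorem pair_lower_mem (hM : IsPartitionCategory M) (a : ℕ) : ofWords [] [a, a] ∈ M :=
  pairPartition_eq_ofWords a ▸ hM.pair_mem

theorem pair_upper_mem (hM : IsPartitionCategory M) (a : ℕ) : ofWords [a, a] [] ∈ M :=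
  (hM.ofWords_append_mem_iff [a, a] [] []).1 (hM.pair_lower_mem a)

end IsPartitionCategory

namespace IsGroupTheoreticalCategory

variable {M : Set PartitionDiagram}

theorem triple_mem (hM : IsGroupTheoreticalCategory M) (c : ℕ) :
    ofWords [c] [c, c, c] ∈ M := by
  obtain ⟨hC, hP⟩ := hM
  rw [pairPositioner_eq_ofWords (a := 0) (b := 1) (by decide)] at hP
  have h₁ : ofWords [0, 0, 1, 0] [1, 0] ∈ M := hC.rotate_up (w := [1, 0]) hP
  have h₂ := hC.comp_mem _ h₁ _ (hC.pair_upper_mem c) rfl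
  rw [comp_ofWords_pair c [0, 0, 1, 0] (by simp)] at h₂
  exact (hC.ofWords_append_mem_iff [c, c, c] [c] []).2 h₂

theorem move_pair_mem (hM : IsGroupTheoreticalCategory M) (a : ℕ) (t : List ℕ) :
    ∀ r, ofWords [] (a :: a :: (t ++ r)) ∈ M → ofWords [] (a :: a :: (r ++ t)) ∈ M := by
  induction t with
  | nil => simp
  | cons b t ih =>
    intro r h
    have h' : ofWords [] (b :: a :: a :: (t ++ r)) ∈ M := by
      by_cases hab : a = b
      · subst hab
        exact h
      · refine hM.1.replace_prefix_mem (u := [a, a, b]) (v := [b, a, a])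
          (pairPositioner_eq_ofWords hab ▸ hM.2) ?_ h
        simp only [List.mem_cons]
        tauto
    have h'' := (hM.1.append_comm_mem_iff [b] (a :: a :: (t ++ r))).1 h'
    simpa using ih (r ++ [b]) (by simpa using h'')

theorem cons_cons_mem_iff (hM : IsGroupTheoreticalCategory M) (a : ℕ) (v : List ℕ) :
    ofWords [] (a :: a :: v) ∈ M ↔ ofWords [] v ∈ M := by
  constructor
  · exact hM.1.replace_prefix_mem (u := [a, a]) (v := []) (hM.1.pair_upper_mem a) (by simp)
  · intro h
    by_cases ha : a ∈ v
    · obtain ⟨s, t, rfl⟩ := List.append_of_mem ha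
      have h₁ := (hM.1.append_comm_mem_iff s (a :: t)).1 h
      have h₂ : ofWords [] (a :: a :: a :: (t ++ s)) ∈ M :=
        hM.1.replace_prefix_mem (u := [a]) (v := [a, a, a]) (hM.triple_mem a) (by simp) h₁
      simpa using hM.move_pair_mem a (a :: t) s h₂
    · refine hM.1.replace_prefix_mem (u := []) (v := [a, a]) (hM.1.pair_lower_mem a) ?_ h
      rintro b hb hba
      simp only [List.mem_cons, List.not_mem_nil, or_false, or_self] at hba
      exact absurd (hba ▸ hb) ha

theorem append_pair_mem_iff (hM : IsGroupTheoreticalCategory M) (a : ℕ) (u v : List ℕ) :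
    ofWords [] (u ++ a :: a :: v) ∈ M ↔ ofWords [] (u ++ v) ∈ M := by
  rw [hM.1.append_comm_mem_iff, hM.1.append_comm_mem_iff u v]
  exact hM.cons_cons_mem_iff a (v ++ u)

theorem append_reduceWord_mem_iff (hM : IsGroupTheoreticalCategory M) (w : List ℕ) :
    ∀ u, ofWords [] (u ++ w) ∈ M ↔ ofWords [] (u ++ reduceWord w) ∈ M := by
  induction w with
  | nil => exact fun _ => Iff.rfl
  | cons x w ih =>
    intro u
    have hx := ih (u ++ [x])
    simp only [List.append_assoc, List.singleton_append] at hx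
    rw [hx]
    change _ ↔ ofWords [] (u ++ (match reduceWord w with
      | [] => [x]
      | y :: rest => if x = y then rest else x :: y :: rest)) ∈ M
    cases reduceWord w with
    | nil => rfl
    | cons y rest =>
      by_cases hxy : x = y
      · subst hxy
        simpa using hM.append_pair_mem_iff x u rest
      · simp [hxy]

end IsGroupTheoreticalCategory

/-- Let `C` be a group-theoretical category of partitions.  A partition
`p ∈ P(0,n)` with no upper points belongs to `C` if and only if its single leg version
belongs to `C`. -/
theorem mem_iff_singleLegVersion_mem (M : Set PartitionDiagram)
    (hM : IsGroupTheoreticalCategory M) (p : PartitionDiagram) (hp : p.upper = 0) :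
    p ∈ M ↔ singleLegVersion p ∈ M := by
  conv_lhs => rw [eq_wordPartition_canonWord p hp]
  rw [singleLegVersion, wordPartition_eq_ofWords, wordPartition_eq_ofWords]
  exact hM.append_reduceWord_mem_iff (canonWord p) []
end

section
/- For every group-theoretical category of partitions C, the category of partitions generated by C_sl together with the pair positioner partition ▷ equals C, i.e. ⟨C_sl ∪ {▷}⟩ = C. -/
open Classical

open PartitionDiagram

namespace PartitionDiagram

/-- The labels of the points of a diagram whose rows are read off from two lists. -/
def rowLabel (up lo : List ℕ) {k l : ℕ} : Fin k ⊕ Fin l → Option ℕ :=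
  Sum.elim (fun i => up[(i : ℕ)]?) (fun j => lo[(j : ℕ)]?)

/-- The partition whose upper and lower rows are labelled by the two given lists; two points
lie in the same block iff their labels coincide. -/
abbrev ofRows (up lo : List ℕ) : PartitionDiagram :=
  ⟨up.length, lo.length, Setoid.ker (rowLabel up lo)⟩

theorem eq_ofRows {p : PartitionDiagram} {up lo : List ℕ} (hu : p.upper = up.length)
    (hl : p.lower = lo.length)
    (h : ∀ x y, p.rel.r x y ↔ rowLabel up lo x = rowLabel up lo y) : p = ofRows up lo := by
  obtain ⟨k, l, r⟩ := p
  dsimp only at hu hl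
  subst hu hl
  have : r = Setoid.ker (rowLabel up lo) := Setoid.ext h
  rw [this, ofRows]

theorem exists_eq_ofRows (p : PartitionDiagram) : ∃ up lo, p = ofRows up lo := by
  obtain ⟨e, he⟩ := exists_injective_nat (Quotient p.rel)
  refine ⟨List.ofFn fun i => e (Quotient.mk p.rel (Sum.inl i)),
    List.ofFn fun j => e (Quotient.mk p.rel (Sum.inr j)), eq_ofRows (by simp) (by simp) ?_⟩
  have key : ∀ z, rowLabel (List.ofFn fun i => e (Quotient.mk p.rel (Sum.inl i)))
      (List.ofFn fun j => e (Quotient.mk p.rel (Sum.inr j))) z =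
        some (e (Quotient.mk p.rel z)) := by
    rintro (i | j) <;> simp [rowLabel]
  intro x y
  rw [key, key, Option.some_inj, he.eq_iff, Quotient.eq]

theorem pairPositioner_eq_ofRows : pairPositioner = ofRows [0, 0, 1] [1, 0, 0] := by
  refine eq_ofRows rfl rfl ?_
  have key : ∀ z : Fin 3 ⊕ Fin 3, rowLabel [0, 0, 1] [1, 0, 0] z =
      some (Sum.elim (fun i : Fin 3 => if (i : ℕ) = 2 then 1 else 0)
        (fun j : Fin 3 => if (j : ℕ) = 0 then 1 else 0) z) := by
    rintro (i | j)
    · fin_cases i <;> rfl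
    · fin_cases j <;> rfl
  intro x y
  exact ((Eq.congr (key x) (key y)).trans Option.some_inj).symm

theorem pairPartition_eq_ofRows (a : ℕ) : pairPartition = ofRows [] [a, a] := by
  refine eq_ofRows rfl rfl ?_
  have key : ∀ z : Fin 0 ⊕ Fin 2, rowLabel [] [a, a] z = some a := by
    rintro (i | j)
    · exact i.elim0
    · fin_cases j <;> rfl
  intro x y
  exact ⟨fun _ => (key x).trans (key y).symm, fun _ => rfl⟩

theorem invol_ofRows (up lo : List ℕ) : invol (ofRows up lo) = ofRows lo up := by
  refine eq_ofRows rfl rfl ?_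
  rintro (x | x) (y | y) <;> rfl

theorem rotLD_ofRows (a : ℕ) (up lo : List ℕ) (h : 0 < (ofRows up (a :: lo)).lower) :
    rotLD (ofRows up (a :: lo)) h = ofRows (a :: up) lo := by
  refine eq_ofRows rfl rfl fun (x y : Fin (up.length + 1) ⊕ Fin lo.length) => Eq.congr ?_ ?_
  · rcases x with ⟨_ | i, hi⟩ | j <;> rfl
  · rcases y with ⟨_ | i, hi⟩ | j <;> rfl

theorem rotLU_ofRows (a : ℕ) (up lo : List ℕ) (h : 0 < (ofRows (a :: up) lo).upper) :
    rotLU (ofRows (a :: up) lo) h = ofRows up (a :: lo) := by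
  refine eq_ofRows rfl rfl fun (x y : Fin up.length ⊕ Fin (lo.length + 1)) => Eq.congr ?_ ?_
  · rcases x with i | ⟨_ | j, hj⟩ <;> rfl
  · rcases y with i | ⟨_ | j, hj⟩ <;> rfl

theorem rotRU_ofRows_singleton (a : ℕ) (lo : List ℕ) (h : 0 < (ofRows [a] lo).upper) :
    rotRU (ofRows [a] lo) h = ofRows [] (lo ++ [a]) := by
  have key : ∀ j, j < lo.length + 1 → (if j < lo.length then lo[j]? else some a) =
      (lo ++ [a])[j]? := by
    intro j hj
    split_ifs with h
    · rw [List.getElem?_append_left h]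
    · obtain rfl : j = lo.length := by omega
      simp
  refine eq_ofRows rfl (by simp [rotRU]) fun (x y : Fin 0 ⊕ Fin (lo.length + 1)) =>
    Eq.congr ?_ ?_
  · rcases x with i | ⟨j, hj⟩
    · exact i.elim0
    · refine Eq.trans ?_ (key j hj)
      by_cases h : j < lo.length <;> simp [rowLabel, h]
  · rcases y with i | ⟨j, hj⟩
    · exact i.elim0
    · refine Eq.trans ?_ (key j hj)
      by_cases h : j < lo.length <;> simp [rowLabel, h]

theorem tensor_ofRows_pair (w : List ℕ) {a : ℕ} (ha : a ∉ w) :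
    tensor (ofRows [] w) (ofRows [] [a, a]) = ofRows [] (w ++ [a, a]) := by
  refine eq_ofRows rfl (by simp [tensor, ofRows]) ?_
  have hne : ∀ i (h : i < w.length), w[i] ≠ a := fun i h e => ha (e ▸ List.getElem_mem h)
  have hrel : ∀ x y : Fin (0 + 0) ⊕ Fin (w.length + 2),
      (tensor (ofRows [] w) (ofRows [] [a, a])).rel.r x y ↔
        Sum.map (Quotient.mk (ofRows [] w).rel) (Quotient.mk (ofRows [] [a, a]).rel)
          (splitPoint x) =
        Sum.map (Quotient.mk (ofRows [] w).rel) (Quotient.mk (ofRows [] [a, a]).rel)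
          (splitPoint y) := fun _ _ => Iff.rfl
  have hleft : ∀ x y : Fin 0 ⊕ Fin w.length,
      (Quotient.mk (ofRows [] w).rel x = Quotient.mk (ofRows [] w).rel y) ↔
        rowLabel [] w x = rowLabel [] w y := fun x y => Quotient.eq
  have hright : ∀ x y : Fin 0 ⊕ Fin 2,
      (Quotient.mk (ofRows [] [a, a]).rel x = Quotient.mk (ofRows [] [a, a]).rel y) ↔
        rowLabel [] [a, a] x = rowLabel [] [a, a] y := fun x y => Quotient.eq
  have hpair : ∀ j : Fin 2, [a, a][(j : ℕ)]? = some a := by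
    intro j; fin_cases j <;> rfl
  have happL : ∀ i : Fin w.length, (w ++ [a, a])[(i : ℕ)]? = some w[(i : ℕ)] := fun i => by
    rw [List.getElem?_append_left i.2, List.getElem?_eq_getElem i.2]
  have happR : ∀ i : Fin 2, (w ++ [a, a])[w.length + (i : ℕ)]? = some a := fun i => by
    rw [List.getElem?_append_right (Nat.le_add_right _ _), Nat.add_sub_cancel_left, hpair]
  rintro (x | x) y
  · exact x.elim0
  obtain y | y := y
  · exact y.elim0
  refine (hrel (Sum.inr x) (Sum.inr y)).trans ?_
  change _ ↔ (w ++ [a, a])[(x : ℕ)]? = (w ++ [a, a])[(y : ℕ)]?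
  obtain ⟨x, rfl⟩ := finSumFinEquiv.surjective x
  obtain ⟨y, rfl⟩ := finSumFinEquiv.surjective y
  obtain x | x := x <;> obtain y | y := y
  all_goals
    simp only [splitPoint, Equiv.symm_apply_apply, Sum.map_inl, Sum.map_inr, Sum.inl.injEq,
      Sum.inr.injEq, reduceCtorEq, hleft, hright]
    simp [rowLabel, hpair, happL, happR, hne, Ne.symm (hne _ _)]

theorem comp_ofRows {up s t : List ℕ} (hts : t ⊆ s) (φ : ℕ → ℕ)
    (h : (ofRows up (s.map φ)).lower = (ofRows s t).upper) :
    comp (ofRows up (s.map φ)) (ofRows s t) h = ofRows up (t.map φ) := by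
  refine eq_ofRows rfl (by simp [comp, ofRows]) ?_
  let lab : Fin up.length ⊕ (Fin (s.map φ).length ⊕ Fin t.length) → Option ℕ :=
    Sum.elim (fun i => up[(i : ℕ)]?) (rowLabel (s.map φ) (t.map φ))
  have labP : ∀ z, lab (iotaP (ofRows up (s.map φ)) (ofRows s t) z) =
      rowLabel up (s.map φ) z := by
    rintro (i | j) <;> rfl
  have labQ : ∀ z, lab (iotaQ (ofRows up (s.map φ)) (ofRows s t) h z) =
      (rowLabel s t z).map φ := by
    rintro (i | j)
    · exact List.getElem?_map
    · exact List.getElem?_map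
  have sound : ∀ x y, Relation.EqvGen (compRel (ofRows up (s.map φ)) (ofRows s t) h) x y →
      lab x = lab y := by
    intro x y hxy
    induction hxy with
    | rel x y hr =>
      obtain ⟨a, b, hab, rfl, rfl⟩ | ⟨a, b, hab, rfl, rfl⟩ := hr
      · rw [labP, labP]; exact hab
      · rw [labQ, labQ]; exact congrArg _ hab
    | refl => rfl
    | symm _ _ _ ih => exact ih.symm
    | trans _ _ _ _ _ ih₁ ih₂ => exact ih₁.trans ih₂
  have lift : ∀ x, ∃ z, Relation.EqvGen (compRel (ofRows up (s.map φ)) (ofRows s t) h) x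
      (iotaP (ofRows up (s.map φ)) (ofRows s t) z) := by
    rintro (i | i | j)
    · exact ⟨Sum.inl i, .refl _⟩
    · exact ⟨Sum.inr i, .refl _⟩
    · obtain ⟨i, hi, e⟩ := List.mem_iff_getElem.1 (hts (List.getElem_mem j.2))
      refine ⟨Sum.inr ⟨i, by simpa [ofRows] using hi⟩,
        .rel _ _ (Or.inr ⟨Sum.inr j, Sum.inl ⟨i, hi⟩, ?_, rfl, rfl⟩)⟩
      have : t[(j : ℕ)]? = s[i]? := by simp [hi, e]
      exact this
  have complete : ∀ x y, lab x = lab y →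
      Relation.EqvGen (compRel (ofRows up (s.map φ)) (ofRows s t) h) x y := by
    intro x y hxy
    obtain ⟨x', hx⟩ := lift x
    obtain ⟨y', hy⟩ := lift y
    refine hx.trans _ _ _ (.trans _ _ _ (.rel _ _ (Or.inl ⟨x', y', ?_, rfl, rfl⟩))
      (hy.symm _ _))
    change rowLabel up (s.map φ) x' = rowLabel up (s.map φ) y'
    rw [← labP, ← labP, ← sound _ _ hx, ← sound _ _ hy, hxy]
  have key : ∀ z : Fin up.length ⊕ Fin t.length,
      lab (Sum.map id Sum.inr z) = rowLabel up (t.map φ) z := by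
    rintro (i | j) <;> rfl
  intro x y
  exact Iff.trans ⟨sound _ _, complete _ _⟩ (Eq.congr (key x) (key y))

theorem exists_eq_append_of_not_isSingleLeg {w : List ℕ} (h : ¬ IsSingleLeg (ofRows [] w)) :
    ∃ u a v, w = u ++ a :: a :: v := by
  unfold IsSingleLeg at h
  push Not at h
  obtain ⟨⟨i, hi⟩, ⟨j, hj⟩, hij, hr⟩ := h rfl
  dsimp only at hij
  subst hij
  replace hi : i < w.length := hi
  replace hj : i + 1 < w.length := hj
  have e : w[i] = w[i + 1] := by
    have : w[i]? = w[i + 1]? := hr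
    simpa [hi, hj] using this
  refine ⟨w.take i, w[i], w.drop (i + 2), ?_⟩
  conv_lhs => rw [← List.take_append_drop i w, List.drop_eq_getElem_cons hi,
    List.drop_eq_getElem_cons hj, ← e]

end PartitionDiagram

namespace IsPartitionCategory

variable {N : Set PartitionDiagram} (hN : IsPartitionCategory N)

include hN

theorem ofRows_mem_iff (up lo : List ℕ) :
    ofRows up lo ∈ N ↔ ofRows [] (up.reverse ++ lo) ∈ N := by
  induction up generalizing lo with
  | nil => rfl
  | cons a up ih =>
    rw [List.reverse_cons, List.append_assoc, List.singleton_append, ← ih]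
    constructor
    · intro h
      rw [← rotLU_ofRows a up lo (Nat.succ_pos _)]
      exact hN.rotLU_mem _ h _
    · intro h
      rw [← rotLD_ofRows a up lo (Nat.succ_pos _)]
      exact hN.rotLD_mem _ h _

theorem ofRows_append_comm {u v : List ℕ} (h : ofRows [] (u ++ v) ∈ N) :
    ofRows [] (v ++ u) ∈ N := by
  induction u generalizing v with
  | nil => simpa using h
  | cons a u ih =>
    have h₁ : ofRows [a] (u ++ v) ∈ N := (hN.ofRows_mem_iff _ _).2 (by simpa using h)
    have h₂ : ofRows [] (u ++ (v ++ [a])) ∈ N := by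
      rw [← List.append_assoc, ← rotRU_ofRows_singleton _ _ (Nat.succ_pos _)]
      exact hN.rotRU_mem _ h₁ _
    simpa using ih h₂

/-- A partition `q` in a category all of whose blocks meet the upper row acts as a rewriting
rule on words. -/
theorem ofRows_rewrite {s t : List ℕ} (hq : ofRows s t ∈ N) (hts : t ⊆ s) (φ : ℕ → ℕ)
    {u v : List ℕ} (h : ofRows [] (u ++ (s.map φ ++ v)) ∈ N) :
    ofRows [] (u ++ (t.map φ ++ v)) ∈ N := by
  rw [← List.append_assoc] at h
  have h₁ := hN.ofRows_append_comm h
  rw [← List.append_assoc, ← List.reverse_reverse (v ++ u), ← hN.ofRows_mem_iff] at h₁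
  have h₂ : ofRows (v ++ u).reverse (t.map φ) ∈ N := by
    rw [← comp_ofRows hts φ (by simp)]
    exact hN.comp_mem _ h₁ _ hq _
  rw [hN.ofRows_mem_iff, List.reverse_reverse, List.append_assoc] at h₂
  simpa using hN.ofRows_append_comm h₂

theorem ofRows_delete_pair {u v : List ℕ} {a : ℕ} (h : ofRows [] (u ++ a :: a :: v) ∈ N) :
    ofRows [] (u ++ v) ∈ N := by
  have hq : ofRows [0, 0] [] ∈ N := by
    rw [← invol_ofRows, ← pairPartition_eq_ofRows]
    exact hN.invol_mem _ hN.pair_mem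
  exact hN.ofRows_rewrite hq (by simp) (fun _ => a) h

variable (hp : pairPositioner ∈ N)

include hp

theorem ofRows_triple {u v : List ℕ} {a : ℕ} (h : ofRows [] (u ++ a :: v) ∈ N) :
    ofRows [] (u ++ a :: a :: a :: v) ∈ N := by
  rw [pairPositioner_eq_ofRows, hN.ofRows_mem_iff] at hp
  have h₁ : ofRows [0, 1] [0, 1, 0, 0] ∈ N := (hN.ofRows_mem_iff _ _).2 hp
  have h₂ : ofRows [] ([] ++ ([0, 1].map (fun _ => 0) ++ [])) ∈ N :=
    pairPartition_eq_ofRows 0 ▸ hN.pair_mem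
  have hq : ofRows [0] [0, 0, 0] ∈ N :=
    (hN.ofRows_mem_iff _ _).2 (hN.ofRows_rewrite h₁ (by simp) _ h₂)
  exact hN.ofRows_rewrite hq (by simp) (fun _ => a) h

theorem ofRows_move_pair {u x v : List ℕ} {a : ℕ}
    (h : ofRows [] (u ++ a :: a :: (x ++ v)) ∈ N) :
    ofRows [] (u ++ x ++ a :: a :: v) ∈ N := by
  induction x generalizing u with
  | nil => simpa using h
  | cons b x ih =>
    rw [pairPositioner_eq_ofRows] at hp
    have h₁ := hN.ofRows_rewrite hp (by simp) (fun i => if i = 0 then a else b) (u := u)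
      (v := x ++ v) h
    have h₂ : ofRows [] ((u ++ [b]) ++ a :: a :: (x ++ v)) ∈ N := by simpa using h₁
    simpa using ih h₂

theorem ofRows_insert_pair {u v : List ℕ} (a : ℕ) (h : ofRows [] (u ++ v) ∈ N) :
    ofRows [] (u ++ a :: a :: v) ∈ N := by
  have h₁ := hN.ofRows_append_comm h
  suffices ofRows [] ((v ++ u) ++ [a, a]) ∈ N by
    rw [List.append_assoc] at this
    simpa using hN.ofRows_append_comm this
  by_cases ha : a ∈ v ++ u
  · obtain ⟨x, y, hxy⟩ := List.append_of_mem ha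
    rw [hxy] at h₁ ⊢
    have h₂ : ofRows [] ((x ++ [a]) ++ a :: a :: (y ++ [])) ∈ N := by
      simpa using hN.ofRows_triple hp h₁
    simpa using hN.ofRows_move_pair hp h₂
  · rw [← tensor_ofRows_pair _ ha, ← pairPartition_eq_ofRows]
    exact hN.tensor_mem _ h₁ _ hN.pair_mem

end IsPartitionCategory

theorem ofRows_mem_of_slSet_subset {M N : Set PartitionDiagram} (hM : IsPartitionCategory M)
    (hN : IsPartitionCategory N) (hp : pairPositioner ∈ N) (hsl : slSet M ⊆ N) (w : List ℕ)
    (hw : ofRows [] w ∈ M) : ofRows [] w ∈ N := by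
  by_cases h : IsSingleLeg (ofRows [] w)
  · exact hsl ⟨hw, h⟩
  · obtain ⟨u, a, v, rfl⟩ := exists_eq_append_of_not_isSingleLeg h
    exact hN.ofRows_insert_pair hp a
      (ofRows_mem_of_slSet_subset hM hN hp hsl (u ++ v) (hM.ofRows_delete_pair hw))
termination_by w.length
decreasing_by subst_vars; simp

/-- For every group-theoretical category of partitions `C`, the category of
partitions generated by `C_sl` together with the pair positioner partition `▷` equals `C`. -/
theorem generated_slSet_union_pairPositioner_eq (M : Set PartitionDiagram)
    (hM : IsGroupTheoreticalCategory M) :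
    generatedCategory (slSet M ∪ {PartitionDiagram.pairPositioner}) = M := by
  obtain ⟨hM, hp⟩ := hM
  refine Set.Subset.antisymm (Set.sInter_subset_of_mem ⟨hM, ?_⟩) ?_
  · rintro p (h | rfl)
    · exact h.1
    · exact hp
  · rintro p hpM N ⟨hN, hS⟩
    obtain ⟨up, lo, rfl⟩ := exists_eq_ofRows p
    rw [hM.ofRows_mem_iff] at hpM
    rw [hN.ofRows_mem_iff]
    exact ofRows_mem_of_slSet_subset hM hN (hS (Or.inr rfl)) (fun q hq => hS (Or.inl hq)) _ hpM
end
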